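/- Let R = ⊕_{i≥0} R_i be a positively graded ring with R_0 a field, let M ≅ I ⊕ N be a graded R-module where I is a graded ideal containing a non-zero-divisor f of degree indeg(I) with Rf ≠ I, indeg(I) < indeg(N), and the degree-indeg_R(m_R) component of tr_R(N) is zero. If tr_R(M) contains a homogeneous R-regular sequence θ₁, θ₂ of degree indeg_R(m_R) and dim_{R_0}(M_{indeg(M)}) = 1, then I has an R(−indeg(I))-free direct summand. -/

import Mathlib

/-- The trace ideal of a module. -/
noncomputable def traceIdeal (R M : Type*) [CommRing R] [AddCommGroup M] [Module R M] :
    Ideal R :=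
  ⨆ φ : M →ₗ[R] R, LinearMap.range φ

section

open DirectSum

/-- The part of shift `e - j` of a linear map from a graded module to the graded ring. -/
noncomputable def shiftPart {R N : Type*} [CommRing R] [AddCommGroup N] [Module R N]
    (𝒜 : ℕ → AddSubgroup R) [GradedRing 𝒜] (𝒩 : ℕ → AddSubgroup N)
    [DirectSum.Decomposition 𝒩] (φ : N →ₗ[R] R) (e j : ℕ) : N →+ R :=
  (DirectSum.toAddMonoid fun k =>
    if j ≤ e + k then
      ((GradedRing.proj 𝒜 (e + k - j)).comp φ.toAddMonoidHom).comp (𝒩 k).subtype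
    else 0).comp (DirectSum.decomposeAddEquiv 𝒩).toAddMonoidHom

theorem shiftPart_apply_of_mem {R N : Type*} [CommRing R] [AddCommGroup N] [Module R N]
    (𝒜 : ℕ → AddSubgroup R) [GradedRing 𝒜] (𝒩 : ℕ → AddSubgroup N)
    [DirectSum.Decomposition 𝒩] (φ : N →ₗ[R] R) (e j : ℕ) {k : ℕ} {n : N} (hn : n ∈ 𝒩 k) :
    shiftPart 𝒜 𝒩 φ e j n =
      if j ≤ e + k then (decompose 𝒜 (φ n) (e + k - j) : R) else 0 := by
  simp only [shiftPart, AddMonoidHom.comp_apply, AddEquiv.toAddMonoidHom_eq_coe,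
    AddMonoidHom.coe_coe, decomposeAddEquiv_apply, decompose_of_mem 𝒩 hn,
    DirectSum.toAddMonoid_of]
  split_ifs <;> simp [GradedRing.proj_apply]

theorem shiftPart_smul {R N : Type*} [CommRing R] [AddCommGroup N] [Module R N]
    (𝒜 : ℕ → AddSubgroup R) [GradedRing 𝒜] (𝒩 : ℕ → AddSubgroup N)
    [DirectSum.Decomposition 𝒩]
    (hsmul : ∀ (i j : ℕ) (r : R) (n : N), r ∈ 𝒜 i → n ∈ 𝒩 j → r • n ∈ 𝒩 (i + j))
    (φ : N →ₗ[R] R) (e j : ℕ) (r : R) (n : N) :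
    shiftPart 𝒜 𝒩 φ e j (r • n) = r * shiftPart 𝒜 𝒩 φ e j n := by
  induction r using DirectSum.Decomposition.inductionOn 𝒜 with
  | zero => simp
  | add a b ha hb => rw [add_smul, map_add, ha, hb, add_mul]
  | @homogeneous i a =>
    induction n using DirectSum.Decomposition.inductionOn 𝒩 with
    | zero => simp
    | add m m' hm hm' => rw [smul_add, map_add, hm, hm', map_add, mul_add]
    | @homogeneous k m =>
      rw [shiftPart_apply_of_mem 𝒜 𝒩 φ e j (hsmul i k a m a.2 m.2),
        shiftPart_apply_of_mem 𝒜 𝒩 φ e j m.2, map_smul, smul_eq_mul,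
        coe_decompose_mul_of_left_mem 𝒜 _ a.2]
      by_cases h : j ≤ e + k
      · rw [if_pos (by omega), if_pos (by omega), if_pos h,
          show e + (i + k) - j - i = e + k - j by omega]
      · rw [if_neg h, mul_zero]
        split_ifs <;> first | rfl | omega

/-- The trace ideal of a graded module is homogeneous. -/
theorem decompose_mem_traceIdeal {R N : Type*} [CommRing R] [AddCommGroup N] [Module R N]
    (𝒜 : ℕ → AddSubgroup R) [GradedRing 𝒜] (𝒩 : ℕ → AddSubgroup N)
    [DirectSum.Decomposition 𝒩]
    (hsmul : ∀ (i j : ℕ) (r : R) (n : N), r ∈ 𝒜 i → n ∈ 𝒩 j → r • n ∈ 𝒩 (i + j))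
    (e : ℕ) {b : R} (hb : b ∈ traceIdeal R N) :
    (decompose 𝒜 b e : R) ∈ traceIdeal R N := by
  induction hb using Submodule.iSup_induction' with
  | zero => simp
  | add x y _ _ hx hy => simpa using add_mem hx hy
  | mem φ x hx =>
    obtain ⟨n, rfl⟩ := hx
    induction n using DirectSum.Decomposition.inductionOn 𝒩 with
    | zero => simp
    | add m m' hm hm' => simpa using add_mem hm hm'
    | @homogeneous j m =>
      let ψ : N →ₗ[R] R :=
        { shiftPart 𝒜 𝒩 φ e j with
          map_smul' := shiftPart_smul 𝒜 𝒩 hsmul φ e j }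
      refine Submodule.mem_iSup_of_mem ψ ⟨m, ?_⟩
      change shiftPart 𝒜 𝒩 φ e j m = _
      rw [shiftPart_apply_of_mem 𝒜 𝒩 φ e j m.2, if_pos (by omega), Nat.add_sub_cancel]

theorem traceIdeal_prod_le (R M N : Type*) [CommRing R] [AddCommGroup M] [Module R M]
    [AddCommGroup N] [Module R N] :
    traceIdeal R (M × N) ≤ traceIdeal R M ⊔ traceIdeal R N := by
  refine iSup_le fun φ => ?_
  rintro _ ⟨⟨m, n⟩, rfl⟩
  have h : φ (m, n) = φ.comp (LinearMap.inl R M N) m + φ.comp (LinearMap.inr R M N) n := by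
    simp [← map_add]
  rw [h]
  exact Submodule.add_mem_sup (Submodule.mem_iSup_of_mem _ ⟨m, rfl⟩)
    (Submodule.mem_iSup_of_mem _ ⟨n, rfl⟩)

/-- The colon ideal of a principal ideal generated by a homogeneous element by a homogeneous
ideal is homogeneous. -/
theorem decompose_mem_colon {R : Type*} [CommRing R] (𝒜 : ℕ → AddSubgroup R) [GradedRing 𝒜]
    {I : Ideal R}
    (hIhom : ∀ (i : ℕ) (x : R), x ∈ I → (decompose 𝒜 x i : R) ∈ I)
    {d : ℕ} {f : R} (hfd : f ∈ 𝒜 d) {a : R}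
    (ha : a ∈ (Ideal.span {f}).colon (I : Set R)) (i : ℕ) :
    (decompose 𝒜 a i : R) ∈ (Ideal.span {f}).colon (I : Set R) := by
  classical
  rw [Submodule.mem_colon] at ha ⊢
  intro x hx
  rw [← sum_support_decompose 𝒜 x, Finset.smul_sum]
  refine sum_mem fun j _ => ?_
  obtain ⟨g, hg⟩ := Ideal.mem_span_singleton.mp (ha _ (hIhom j x hx))
  have h := coe_decompose_mul_of_right_mem 𝒜 (i + j) (a := a) (decompose 𝒜 x j).2
  rw [if_pos (by omega), Nat.add_sub_cancel] at h
  rw [smul_eq_mul, ← h, ← smul_eq_mul a, hg, coe_decompose_mul_of_left_mem 𝒜 _ hfd,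
    Ideal.mem_span_singleton]
  split_ifs <;> simp

/-- If no nonzero constant lies in `(f) : I`, then the degree `e` components of elements of
the trace ideal of `I` lie in `(f) : I`. -/
theorem decompose_mem_colon_of_mem_traceIdeal {R : Type*} [CommRing R]
    (𝒜 : ℕ → AddSubgroup R) [GradedRing 𝒜] {I : Ideal R}
    (hIhom : ∀ (i : ℕ) (x : R), x ∈ I → (decompose 𝒜 x i : R) ∈ I)
    {d : ℕ} {f : R} (hfI : f ∈ I) (hfd : f ∈ 𝒜 d) (hf : f ∈ nonZeroDivisors R)
    (hdmin : ∀ i, i < d → ∀ x ∈ I, x ∈ 𝒜 i → x = 0)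
    {e : ℕ} (he : ∀ i, 0 < i → i < e → ∀ x ∈ 𝒜 i, x = 0)
    (hdim : ∀ x ∈ I, x ∈ 𝒜 d → ∃ c ∈ 𝒜 0, x = c * f)
    (hconst : ∀ c ∈ 𝒜 0, c ∈ (Ideal.span {f}).colon (I : Set R) → c = 0)
    {t : R} (ht : t ∈ traceIdeal R I) :
    (decompose 𝒜 t e : R) ∈ (Ideal.span {f}).colon (I : Set R) := by
  classical
  induction ht using Submodule.iSup_induction' with
  | zero => simp
  | add x y _ _ hx hy => simpa using add_mem hx hy
  | mem φ x hx =>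
    obtain ⟨x, rfl⟩ := hx
    have hcomm (y : I) : φ ⟨f, hfI⟩ * y = φ y * f := by
      have h : (y : R) • (⟨f, hfI⟩ : I) = f • y := Subtype.ext (mul_comm _ _)
      have h' := congrArg φ h
      simp only [map_smul, smul_eq_mul] at h'
      linear_combination h'
    have hJ : φ ⟨f, hfI⟩ ∈ (Ideal.span {f}).colon (I : Set R) := by
      rw [Submodule.mem_colon]
      intro y hy
      exact Ideal.mem_span_singleton.mpr ⟨φ ⟨y, hy⟩, (hcomm ⟨y, hy⟩).trans (mul_comm _ _)⟩
    have key : (decompose 𝒜 (φ ⟨f, hfI⟩ * x) (e + d) : R) ∈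
        (Ideal.span {f}).colon (I : Set R) * Ideal.span {f} := by
      rw [decompose_mul, coe_mul_apply]
      refine sum_mem fun ij hij => ?_
      have hsum : ij.1 + ij.2 = e + d := (Finset.mem_filter.mp hij).2
      have hJi := decompose_mem_colon 𝒜 hIhom hfd hJ ij.1
      have hxj := hIhom ij.2 x x.2
      rcases lt_or_ge ij.2 d with hd | hd
      · rw [hdmin _ hd _ hxj (SetLike.coe_mem _), mul_zero]
        exact zero_mem _
      rcases hd.eq_or_lt with hd | hd
      · obtain ⟨c, -, hc⟩ := hdim _ hxj (hd ▸ SetLike.coe_mem _)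
        rw [hc, ← mul_assoc]
        exact Ideal.mul_mem_mul (Ideal.mul_mem_right _ _ hJi) (Ideal.mem_span_singleton_self f)
      · have h0 : (decompose 𝒜 (φ ⟨f, hfI⟩) ij.1 : R) = 0 := by
          rcases Nat.eq_zero_or_pos ij.1 with hi | hi
          · exact hconst _ (hi ▸ SetLike.coe_mem _) hJi
          · exact he _ hi (by omega) _ (SetLike.coe_mem _)
        rw [h0, zero_mul]
        exact zero_mem _
    rw [hcomm, coe_decompose_mul_of_right_mem 𝒜 _ hfd, if_pos (by omega), Nat.add_sub_cancel,
      Ideal.mem_mul_span_singleton] at key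
    obtain ⟨z, hz, hzf⟩ := key
    rwa [← mul_cancel_right_mem_nonZeroDivisors hf |>.mp hzf]

/-- If `(f) : I` contains a regular sequence of length two, then `I ⊆ (f)`. -/
theorem le_span_singleton_of_regular_mem_colon {R : Type*} [CommRing R] {I : Ideal R} {f : R}
    (hf : f ∈ nonZeroDivisors R) {θ₁ θ₂ : R}
    (h₁ : θ₁ ∈ (Ideal.span {f}).colon (I : Set R))
    (h₂ : θ₂ ∈ (Ideal.span {f}).colon (I : Set R))
    (hθ₁ : θ₁ ∈ nonZeroDivisors R)
    (hθ₂ : ∀ r : R, θ₂ * r ∈ Ideal.span {θ₁} → r ∈ Ideal.span {θ₁}) :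
    I ≤ Ideal.span {f} := by
  intro x hx
  obtain ⟨g₁, hg₁⟩ := Ideal.mem_span_singleton.mp (Submodule.mem_colon.mp h₁ x hx)
  obtain ⟨g₂, hg₂⟩ := Ideal.mem_span_singleton.mp (Submodule.mem_colon.mp h₂ x hx)
  rw [smul_eq_mul] at hg₁ hg₂
  have h : θ₂ * g₁ = θ₁ * g₂ := (mul_cancel_right_mem_nonZeroDivisors hf).mp (by
    linear_combination θ₁ * hg₂ - θ₂ * hg₁)
  obtain ⟨k, hk⟩ := Ideal.mem_span_singleton.mp
    (hθ₂ g₁ (Ideal.mem_span_singleton.mpr ⟨g₂, h⟩))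
  refine Ideal.mem_span_singleton.mpr ⟨k, (mul_cancel_right_mem_nonZeroDivisors hθ₁).mp ?_⟩
  linear_combination hg₁ + f * hk

end

/-- M = I ⊕ N with I a graded ideal containing a non-zero-divisor f
of degree d = indeg(I), Rf ≠ I, indeg(N) > d, and tr_R(N) vanishing in degree
e = indeg(m_R).  If tr_R(M) contains a homogeneous regular sequence θ₁, θ₂ of
degree e, and dim_{R₀} M_d = 1 (the degree-d part of M is I_d, spanned by f over
R₀ = 𝒜 0), then I has an R(−d)-free summand. -/
theorem stmt9 (R : Type*) [CommRing R] (𝒜 : ℕ → AddSubgroup R) [GradedRing 𝒜]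
    (hfield : ∀ x ∈ 𝒜 0, x ≠ 0 → ∃ y ∈ 𝒜 0, x * y = 1)
    (I : Ideal R)
    (hIhom : ∀ (i : ℕ) (x : R), x ∈ I → (DirectSum.decompose 𝒜 x i : R) ∈ I)
    (d : ℕ) (f : R) (hfI : f ∈ I) (hfd : f ∈ 𝒜 d) (hf : f ∈ nonZeroDivisors R)
    (hdmin : ∀ i, i < d → ∀ x ∈ I, x ∈ 𝒜 i → x = 0)
    (hRf : Ideal.span {f} ≠ I)
    -- N : a graded R-module with indeg(N) > d
    (N : Type*) [AddCommGroup N] [Module R N]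
    (𝒩 : ℕ → AddSubgroup N) [DirectSum.Decomposition 𝒩]
    (hsmul : ∀ (i j : ℕ) (r : R) (n : N), r ∈ 𝒜 i → n ∈ 𝒩 j → r • n ∈ 𝒩 (i + j))
    (hNindeg : ∀ j, j ≤ d → ∀ n ∈ 𝒩 j, n = 0)
    -- e = indeg(m_R)
    (e : ℕ) (hepos : 0 < e) (he : ∀ i, 0 < i → i < e → ∀ x ∈ 𝒜 i, x = 0)
    -- [tr_R(N)]_e = 0
    (htrN : ∀ x ∈ traceIdeal R N, x ∈ 𝒜 e → x = 0)
    -- tr_R(M) contains a regular sequence of degree e, where M := I ⊕ N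
    (θ₁ θ₂ : R)
    (hθ₁tr : θ₁ ∈ traceIdeal R (↥I × N)) (hθ₂tr : θ₂ ∈ traceIdeal R (↥I × N))
    (hθ₁e : θ₁ ∈ 𝒜 e) (hθ₂e : θ₂ ∈ 𝒜 e)
    (hθ₁ : θ₁ ∈ nonZeroDivisors R)
    (hθ₂ : ∀ r : R, θ₂ * r ∈ Ideal.span {θ₁} → r ∈ Ideal.span {θ₁})
    -- dim_{R₀}(M_{indeg M}) = 1: M_d = I_d × 0 is spanned over R₀ = 𝒜 0 by f ≠ 0
    (hf0 : f ≠ 0)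
    (hdim : ∀ x ∈ I, x ∈ 𝒜 d → ∃ c ∈ 𝒜 0, x = c * f) :
    ∃ (φ : ↥I →ₗ[R] R) (x : ↥I),
      (∀ (n : ℕ) (a : ↥I), (a : R) ∈ 𝒜 (n + d) → φ a ∈ 𝒜 n) ∧
      (x : R) ∈ 𝒜 d ∧ φ x = 1 := by
  refine absurd (le_antisymm ((Ideal.span_singleton_le_iff_mem I).mpr hfI) ?_) hRf
  by_contra hle
  have hconst : ∀ c ∈ 𝒜 0, c ∈ (Ideal.span {f}).colon (I : Set R) → c = 0 := by
    intro c hc hcJ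
    by_contra hc0
    obtain ⟨y, -, hy⟩ := hfield c hc hc0
    refine hle fun x hx => ?_
    have h := Ideal.mul_mem_left _ y (Submodule.mem_colon.mp hcJ x hx)
    rwa [smul_eq_mul, ← mul_assoc, mul_comm y, hy, one_mul] at h
  have hmem : ∀ θ ∈ traceIdeal R (↥I × N), θ ∈ 𝒜 e →
      θ ∈ (Ideal.span {f}).colon (I : Set R) := by
    intro θ hθ hθe
    obtain ⟨a, ha, b, hb, rfl⟩ := Submodule.mem_sup.mp (traceIdeal_prod_le R I N hθ)
    have hbe := htrN _ (decompose_mem_traceIdeal 𝒜 𝒩 hsmul e hb) (SetLike.coe_mem _)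
    rw [← DirectSum.decompose_of_mem_same 𝒜 hθe, DirectSum.decompose_add, DirectSum.add_apply,
      AddMemClass.coe_add, hbe, add_zero]
    exact decompose_mem_colon_of_mem_traceIdeal 𝒜 hIhom hfI hfd hf hdmin he hdim hconst ha
  exact hle (le_span_singleton_of_regular_mem_colon hf (hmem θ₁ hθ₁tr hθ₁e)
    (hmem θ₂ hθ₂tr hθ₂e) hθ₁ hθ₂)
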